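/- Let λ̲ be a cup diagram and μ̄ a cap diagram. If there exist a ∇-orientation of λ̲ and a Δ-orientation of μ̄ whose sets of assigned integers coincide, then the circle diagram λ̲μ̄ is orientable. -/

import Mathlib

/-- A rational number is a *half-integer*, i.e. of the form `k + 1/2` for an integer `k`. -/
def IsHalfInt (q : ℚ) : Prop := ∃ k : ℤ, q = (k : ℚ) + 1/2

/-- A *cup diagram* (the same notion is also used for cap diagrams): a finite set of
arcs `(a, b)` of half-integers with `a < b` (the *left* and *right endpoints*), such that
all endpoints of all arcs are pairwise distinct, and every half-integer strictly between
the endpoints of an arc is an endpoint of an arc nested inside it. -/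
structure ArcDiagram where
  arcs : Finset (ℚ × ℚ)
  half_left : ∀ c ∈ arcs, IsHalfInt c.1
  half_right : ∀ c ∈ arcs, IsHalfInt c.2
  lt : ∀ c ∈ arcs, c.1 < c.2
  distinct : ∀ c ∈ arcs, ∀ c' ∈ arcs, c ≠ c' →
    c.1 ≠ c'.1 ∧ c.1 ≠ c'.2 ∧ c.2 ≠ c'.1 ∧ c.2 ≠ c'.2
  nested : ∀ c ∈ arcs, ∀ x : ℚ, IsHalfInt x → c.1 < x → x < c.2 →
    ∃ c' ∈ arcs, (x = c'.1 ∨ x = c'.2) ∧ c.1 ≤ c'.1 ∧ c'.2 ≤ c.2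

/-- `x` is covered by (i.e. is an endpoint of) an arc of the diagram `D`. -/
def ArcDiagram.Cov (D : ArcDiagram) (x : ℚ) : Prop := ∃ c ∈ D.arcs, x = c.1 ∨ x = c.2

/-- Adjacency in the circle diagram with bottom cup diagram `lam` and top cap diagram `mu`:
`x` and `y` are joined by a cup of `lam` or a cap of `mu`. -/
def CircAdj (lam mu : ArcDiagram) (x y : ℚ) : Prop :=
  (x, y) ∈ lam.arcs ∨ (y, x) ∈ lam.arcs ∨ (x, y) ∈ mu.arcs ∨ (y, x) ∈ mu.arcs

/-- `x` and `y` lie in the same connected component of the circle diagram `lam mu`. -/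
def CircConn (lam mu : ArcDiagram) : ℚ → ℚ → Prop := Relation.ReflTransGen (CircAdj lam mu)

/-- The circle diagram `lam mu` contains a circle, i.e. a connected component all of whose
vertices lie on both a cup and a cap (every vertex has degree two, so the component is a
closed cycle). -/
def HasCircle (lam mu : ArcDiagram) : Prop :=
  ∃ x : ℚ, ∀ y : ℚ, CircConn lam mu x y → lam.Cov y ∧ mu.Cov y

/-- `g` is the re-indexing map from `A` onto `B`: an order-preserving bijection from `A`
onto `B` equal to the identity outside a finite set. -/
def IsReindex (A B : Set ℚ) (g : ℚ → ℚ) : Prop :=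
  Set.BijOn g A B ∧ StrictMonoOn g A ∧ {x ∈ A | g x ≠ x}.Finite

/-- The set of half-integers not covered by an arc of `D` (the positions of the rays). -/
def RayDomain (D : ArcDiagram) : Set ℚ := {x | IsHalfInt x ∧ ¬ D.Cov x}

/-- The target of the re-indexing of the bottom rays of a cup diagram with `k` cups:
all half-integers except `-k-1/2, -k+1/2, …, k-3/2`. -/
def BotTarget (k : ℕ) : Set ℚ :=
  {x | IsHalfInt x ∧ (x < -(k : ℚ) - 1/2 ∨ (k : ℚ) - 3/2 < x)}

/-- The target of the re-indexing of the top rays of a cap diagram with `l` caps: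
all half-integers except `-l+1/2, …, l-1/2`. -/
def TopTarget (l : ℕ) : Set ℚ :=
  {x | IsHalfInt x ∧ (x < -(l : ℚ) + 1/2 ∨ (l : ℚ) - 1/2 < x)}

/-- The circle diagram with bottom cup diagram `lam` and top cap diagram `mu` is
*orientable*: it contains no circle, every non-propagating line both of whose ends are
top rays has one re-indexed end position `< 0` and one `> 0`, and every non-propagating
line both of whose ends are bottom rays has one re-indexed end position `< -1` and one
`> -1`. -/
def Orientable (lam mu : ArcDiagram) : Prop :=
  ¬ HasCircle lam mu ∧
  ∀ g h : ℚ → ℚ,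
    IsReindex (RayDomain lam) (BotTarget lam.arcs.card) g →
    IsReindex (RayDomain mu) (TopTarget mu.arcs.card) h →
    (∀ x y : ℚ, x ≠ y → CircConn lam mu x y → ¬ mu.Cov x → ¬ mu.Cov y →
        (h x < 0 ∧ 0 < h y) ∨ (h y < 0 ∧ 0 < h x)) ∧
    (∀ x y : ℚ, x ≠ y → CircConn lam mu x y → ¬ lam.Cov x → ¬ lam.Cov y →
        (g x < -1 ∧ -1 < g y) ∨ (g y < -1 ∧ -1 < g x))

/-- A `∇`-orientation of a cup diagram `lam`: it assigns to each cup with endpoints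
`a < b` an integer equal to `a - 1/2` or `b + 1/2`, the assigned integers being pairwise
distinct. -/
def IsNablaOrientation (lam : ArcDiagram) (f : ℚ × ℚ → ℤ) : Prop :=
  (∀ c ∈ lam.arcs, (f c : ℚ) = c.1 - 1/2 ∨ (f c : ℚ) = c.2 + 1/2) ∧
  (∀ c ∈ lam.arcs, ∀ c' ∈ lam.arcs, f c = f c' → c = c')

/-- A `Δ`-orientation of a cap diagram `mu`: it assigns to each cap with endpoints
`a < b` an integer `m` with `a < m < b` such that every other cap with endpoints
`a' < m < b'` satisfies `a' < a` and `b < b'`, the assigned integers being pairwise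
distinct. -/
def IsDeltaOrientation (mu : ArcDiagram) (f : ℚ × ℚ → ℤ) : Prop :=
  (∀ c ∈ mu.arcs, c.1 < (f c : ℚ) ∧ (f c : ℚ) < c.2 ∧
      ∀ c' ∈ mu.arcs, c' ≠ c → c'.1 < (f c : ℚ) → (f c : ℚ) < c'.2 →
        c'.1 < c.1 ∧ c.2 < c'.2) ∧
  (∀ c ∈ mu.arcs, ∀ c' ∈ mu.arcs, f c = f c' → c = c')


structure ZD (A : Finset (ℤ × ℤ)) : Prop where
  lt : ∀ c ∈ A, c.1 < c.2
  distinct : ∀ c ∈ A, ∀ c' ∈ A, c ≠ c' →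
    c.1 ≠ c'.1 ∧ c.1 ≠ c'.2 ∧ c.2 ≠ c'.1 ∧ c.2 ≠ c'.2
  nested : ∀ c ∈ A, ∀ x : ℤ, c.1 < x → x < c.2 →
    ∃ c' ∈ A, (x = c'.1 ∨ x = c'.2) ∧ c.1 ≤ c'.1 ∧ c'.2 ≤ c.2

def ZCov (A : Finset (ℤ × ℤ)) (x : ℤ) : Prop := ∃ c ∈ A, x = c.1 ∨ x = c.2

def zgen (A : Finset (ℤ × ℤ)) (a b : ℤ) : Prop := ∃ c ∈ A, a = c.1 ∧ b = c.2 + 1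

def zset (A : Finset (ℤ × ℤ)) : Setoid ℤ := Relation.EqvGen.setoid (zgen A)

def zcls (A : Finset (ℤ × ℤ)) (m : ℤ) : Quotient (zset A) := Quotient.mk (zset A) m

lemma zcls_arc {A : Finset (ℤ × ℤ)} {c : ℤ × ℤ} (hc : c ∈ A) :
    zcls A c.1 = zcls A (c.2 + 1) :=
  Quotient.sound (Relation.EqvGen.rel _ _ ⟨c, hc, rfl, rfl⟩)

lemma zcls_inv {A : Finset (ℤ × ℤ)} {X : Type*} (f : ℤ → X)
    (hf : ∀ c ∈ A, f c.1 = f (c.2 + 1)) {m n : ℤ} (h : zcls A m = zcls A n) : f m = f n := by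
  have h' : Relation.EqvGen (zgen A) m n := Quotient.exact h
  clear h
  induction h' with
  | rel x y h => obtain ⟨c, hc, rfl, rfl⟩ := h; exact hf c hc
  | refl => rfl
  | symm x y _ ih => exact ih.symm
  | trans x y z h1 h2 ih1 ih2 =>
    exact ih1.trans ih2

lemma ZD.same {A : Finset (ℤ × ℤ)} (hA : ZD A) {c c' : ℤ × ℤ} (hc : c ∈ A) (hc' : c' ∈ A)
    {x : ℤ} (h : x = c.1 ∨ x = c.2) (h' : x = c'.1 ∨ x = c'.2) : c = c' := by
  by_contra hne
  have := hA.distinct c hc c' hc' hne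
  grind

lemma ZD.sat_arc {A : Finset (ℤ × ℤ)} (hA : ZD A) {c : ℤ × ℤ} (hc : c ∈ A) :
    ∀ d ∈ A, (c.1 < d.1 ∧ d.1 ≤ c.2) = (c.1 < d.2 + 1 ∧ d.2 + 1 ≤ c.2) := by
  intro d hd
  have l1 := hA.lt d hd
  have l2 := hA.lt c hc
  by_cases hcd : c = d
  · subst hcd; simp
  have hdis := hA.distinct c hc d hd hcd
  apply propext
  constructor
  · rintro ⟨h1, h2⟩
    obtain ⟨e, he, h3, h4, h5⟩ := hA.nested c hc d.1 h1 (by omega)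
    have := hA.same he hd h3 (Or.inl rfl)
    subst this
    omega
  · rintro ⟨h1, h2⟩
    obtain ⟨e, he, h3, h4, h5⟩ := hA.nested c hc d.2 (by omega) (by omega)
    have := hA.same he hd h3 (Or.inr rfl)
    subst this
    omega

lemma ZD.sat_ray {A : Finset (ℤ × ℤ)} (hA : ZD A) {r : ℤ} (hr : ¬ ZCov A r) :
    ∀ d ∈ A, (d.1 ≤ r) = (d.2 + 1 ≤ r) := by
  intro d hd
  have l1 := hA.lt d hd
  have h1 : r ≠ d.1 := fun h => hr ⟨d, hd, Or.inl h⟩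
  have h2 : r ≠ d.2 := fun h => hr ⟨d, hd, Or.inr h⟩
  apply propext
  constructor
  · intro h
    by_contra h3
    obtain ⟨e, he, h3, h4, h5⟩ := hA.nested d hd r (by omega) (by omega)
    exact hr ⟨e, he, h3⟩
  · intro h; omega

lemma exists_lb (A : Finset (ℤ × ℤ)) : ∃ N : ℤ, ∀ c ∈ A, N < c.1 ∧ N < c.2 ∧ c.1 < -N ∧ c.2 < -N := by
  induction A using Finset.induction_on with
  | empty => exact ⟨0, by simp⟩
  | insert a s ha ih =>
    obtain ⟨N, hN⟩ := ih
    refine ⟨min N (min (min (a.1-1) (a.2-1)) (min (-a.1-1) (-a.2-1))), ?_⟩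
    intro c hc
    rcases Finset.mem_insert.1 hc with rfl | h
    · omega
    · have := hN c h; omega

/-- walk to the left -/
lemma ZD.walk {A : Finset (ℤ × ℤ)} (hA : ZD A) (m : ℤ) :
    ∃ m' ≤ m, zcls A m' = zcls A m ∧ ∀ c ∈ A, c.2 + 1 ≠ m' := by
  obtain ⟨N, hN⟩ := exists_lb A
  have key : ∀ n : ℕ, ∀ m : ℤ, m ≤ N + n →
      ∃ m' ≤ m, zcls A m' = zcls A m ∧ ∀ c ∈ A, c.2 + 1 ≠ m' := by
    intro n
    induction n with
    | zero =>
      intro m hm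
      refine ⟨m, le_rfl, rfl, fun c hc => ?_⟩
      have := hN c hc
      simp at hm; omega
    | succ n ih =>
      intro m hm
      by_cases h : ∀ c ∈ A, c.2 + 1 ≠ m
      · exact ⟨m, le_rfl, rfl, h⟩
      · push Not at h
        obtain ⟨c, hc, rfl⟩ := h
        have := hA.lt c hc
        obtain ⟨m', h1, h2, h3⟩ := ih c.1 (by push_cast at hm; omega)
        exact ⟨m', by omega, h2.trans (zcls_arc hc), h3⟩
  exact key (m - N).toNat m (by omega)

lemma sum_sat {A : Finset (ℤ × ℤ)} (R : Finset ℤ) (φ : ℤ → ZMod 2) [DecidableEq (Quotient (zset A))]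
    (hφ : ∀ m ∈ R, ∑ n ∈ R with zcls A n = zcls A m, φ n = 0)
    (S : ℤ → Prop) [DecidablePred S] (hS : ∀ d ∈ A, S d.1 = S (d.2 + 1)) :
    ∑ n ∈ R with S n, φ n = 0 := by
  rw [← Finset.sum_fiberwise_of_maps_to (g := zcls A) (t := (R.filter S).image (zcls A))
    (fun x hx => Finset.mem_image_of_mem _ hx)]
  apply Finset.sum_eq_zero
  intro q hq
  obtain ⟨m, hm, rfl⟩ := Finset.mem_image.1 hq
  rw [Finset.mem_filter] at hm
  rw [← hφ m hm.1]
  apply Finset.sum_congr _ (fun _ _ => rfl)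
  ext n
  simp only [Finset.mem_filter]
  constructor
  · rintro ⟨⟨h1, h2⟩, h3⟩; exact ⟨h1, h3⟩
  · rintro ⟨h1, h3⟩
    exact ⟨⟨h1, (zcls_inv S hS h3).mpr hm.2⟩, h3⟩

lemma cyc {α β : Type*} [DecidableEq α] [DecidableEq β] (R : Finset ℤ) (hR : R.Nonempty)
    (t : ℤ → α) (b : ℤ → β) (hcard : (R.image t).card + (R.image b).card ≤ R.card) :
    ∃ φ : ℤ → ZMod 2, (∃ m ∈ R, φ m ≠ 0) ∧
      (∀ m ∈ R, ∑ n ∈ R with t n = t m, φ n = 0) ∧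
      (∀ m ∈ R, ∑ n ∈ R with b n = b m, φ n = 0) := by
  classical
  let ext : (R → ZMod 2) →ₗ[ZMod 2] (ℤ → ZMod 2) :=
    { toFun := fun f n => if h : n ∈ R then f ⟨n, h⟩ else 0
      map_add' := by intro f g; funext n; by_cases h : n ∈ R <;> simp [h]
      map_smul' := by intro f g; funext n; by_cases h : n ∈ R <;> simp [h] }
  let T : (R → ZMod 2) →ₗ[ZMod 2] ((R.image t → ZMod 2) × (R.image b → ZMod 2)) :=
    { toFun := fun f => (fun a => ∑ n ∈ R with t n = a, ext f n, fun a => ∑ n ∈ R with b n = a, ext f n)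
      map_add' := by
        intro f g
        ext a <;> simp [Finset.sum_add_distrib]
      map_smul' := by
        intro f g
        ext a <;> simp [Finset.mul_sum] }
  have hT : ¬ Function.Injective T := by
    intro hinj
    have hfr : Module.finrank (ZMod 2) (R → ZMod 2) =
        Module.finrank (ZMod 2) ((R.image t → ZMod 2) × (R.image b → ZMod 2)) := by
      apply le_antisymm (LinearMap.finrank_le_finrank_of_injective hinj)
      simp only [Module.finrank_prod, Module.finrank_fintype_fun_eq_card, Fintype.card_coe]
      exact hcard
    have hsurj := (LinearMap.injective_iff_surjective_of_finrank_eq_finrank hfr).1 hinj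
    obtain ⟨m, hm⟩ := hR
    obtain ⟨f, hf⟩ := hsurj (Pi.single ⟨t m, Finset.mem_image_of_mem _ hm⟩ 1, 0)
    have h1 : ∑ n ∈ R, ext f n = 1 := by
      rw [← Finset.sum_fiberwise_of_maps_to (g := t) (t := R.image t)
        (fun x hx => Finset.mem_image_of_mem _ hx), ← Finset.sum_coe_sort (R.image t)]
      have : ∀ a : R.image t, ∑ n ∈ R with t n = a, ext f n = (T f).1 a := fun a => rfl
      rw [Finset.sum_congr rfl (fun a _ => this a), hf]
      simp
    have h2 : ∑ n ∈ R, ext f n = 0 := by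
      rw [← Finset.sum_fiberwise_of_maps_to (g := b) (t := R.image b)
        (fun x hx => Finset.mem_image_of_mem _ hx), ← Finset.sum_coe_sort (R.image b)]
      have : ∀ a : R.image b, ∑ n ∈ R with b n = a, ext f n = (T f).2 a := fun a => rfl
      rw [Finset.sum_congr rfl (fun a _ => this a), hf]
      simp
    rw [h1] at h2
    exact one_ne_zero h2
  rw [injective_iff_map_eq_zero] at hT
  push Not at hT
  obtain ⟨f, hf, hf0⟩ := hT
  refine ⟨ext f, ?_, ?_, ?_⟩
  · obtain ⟨⟨m, hm⟩, h⟩ := Function.ne_iff.1 hf0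
    exact ⟨m, hm, by simpa [ext, hm] using h⟩
  · intro m hm
    exact congrFun (congrArg Prod.fst hf) ⟨t m, Finset.mem_image_of_mem _ hm⟩
  · intro m hm
    exact congrFun (congrArg Prod.snd hf) ⟨b m, Finset.mem_image_of_mem _ hm⟩

lemma pair_sum {A : Finset (ℤ × ℤ)} (hA : ZD A) (u : ℤ → ZMod 2) (hu : ∀ c ∈ A, u c.1 = u c.2)
    (P : Finset ℤ) (hP : ∀ c ∈ A, c.1 ∈ P ↔ c.2 ∈ P) (hz : ∀ x ∈ P, ¬ ZCov A x → u x = 0) :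
    ∑ x ∈ P, u x = 0 := by
  classical
  have h1 : ∑ x ∈ (A.filter (fun c => c.1 ∈ P)).biUnion (fun c => {c.1, c.2}), u x = ∑ x ∈ P, u x := by
    apply Finset.sum_subset
    · intro x hx
      simp only [Finset.mem_biUnion, Finset.mem_filter, Finset.mem_insert,
        Finset.mem_singleton] at hx
      obtain ⟨c, ⟨hc, hcP⟩, rfl | rfl⟩ := hx
      · exact hcP
      · exact (hP c hc).1 hcP
    · intro x hx hx'
      apply hz x hx
      rintro ⟨c, hc, h⟩
      apply hx'
      simp only [Finset.mem_biUnion, Finset.mem_filter, Finset.mem_insert,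
        Finset.mem_singleton]
      refine ⟨c, ⟨hc, ?_⟩, h⟩
      rcases h with rfl | rfl
      · exact hx
      · exact (hP c hc).2 hx
  rw [← h1, Finset.sum_biUnion]
  · apply Finset.sum_eq_zero
    intro c hc
    have hc := (Finset.mem_filter.1 hc).1
    rw [Finset.sum_pair (hA.lt c hc).ne, hu c hc]
    exact CharTwo.add_self_eq_zero _
  · intro c hc d hd hcd
    have hc := (Finset.mem_filter.1 hc).1
    have hd := (Finset.mem_filter.1 hd).1
    rw [Function.onFun, Finset.disjoint_left]
    intro x hx hx'
    simp only [Finset.mem_insert, Finset.mem_singleton] at hx hx'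
    exact hcd (hA.same hc hd hx hx')

lemma sum_split (u : ℤ → ZMod 2) {a b c : ℤ} (h1 : a ≤ b) (h2 : b ≤ c) :
    ∑ x ∈ Finset.Ico a c, u x = ∑ x ∈ Finset.Ico a b, u x + ∑ x ∈ Finset.Ico b c, u x := by
  rw [← Finset.Ico_union_Ico_eq_Ico h1 h2, Finset.sum_union (Finset.Ico_disjoint_Ico_consecutive _ _ _)]

lemma w_arc {A : Finset (ℤ × ℤ)} (hA : ZD A) (u : ℤ → ZMod 2) (hu : ∀ c ∈ A, u c.1 = u c.2)
    (N : ℤ) (hN : ∀ c ∈ A, N < c.1) (c : ℤ × ℤ) (hc : c ∈ A) :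
    ∑ x ∈ Finset.Ico N c.1, u x = ∑ x ∈ Finset.Ico N (c.2 + 1), u x := by
  have h1 := hN c hc
  have h2 := hA.lt c hc
  rw [sum_split u (b := c.1) (c := c.2 + 1) h1.le (by omega)]
  rw [pair_sum hA u hu (Finset.Ico c.1 (c.2+1)), add_zero]
  · intro d hd
    simp only [Finset.mem_Ico]
    by_cases hcd : c = d
    · subst hcd; omega
    have h3 := hA.sat_arc hc d hd
    have h4 := hA.distinct c hc d hd hcd
    have h5 := hA.lt d hd
    have h3 := iff_of_eq h3
    omega
  · intro x hx hx'
    rw [Finset.mem_Ico] at hx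
    exfalso
    apply hx'
    by_cases e1 : x = c.1
    · exact ⟨c, hc, Or.inl e1⟩
    by_cases e2 : x = c.2
    · exact ⟨c, hc, Or.inr e2⟩
    obtain ⟨d, hd, h, _⟩ := hA.nested c hc x (by omega) (by omega)
    exact ⟨d, hd, h⟩

lemma star {A B : Finset (ℤ × ℤ)} (hA : ZD A) (hB : ZD B) (ν δ : ℤ × ℤ → ℤ)
    (hν : ∀ c ∈ A, ν c = c.1 ∨ ν c = c.2 + 1)
    (hδ : ∀ c ∈ B, c.1 < δ c ∧ δ c ≤ c.2 ∧ ∀ c' ∈ B, c' ≠ c → c'.1 < δ c → δ c ≤ c'.2 →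
      c'.1 < c.1 ∧ c.2 < c'.2)
    (him : A.image ν = B.image δ) (u : ℤ → ZMod 2)
    (huA : ∀ c ∈ A, u c.1 = u c.2) (huB : ∀ c ∈ B, u c.1 = u c.2)
    (hu0 : ∀ x, ¬ ZCov B x → u x = 0) : ∀ x, u x = 0 := by
  classical
  obtain ⟨N, hN⟩ := exists_lb (A ∪ B)
  have hNA : ∀ c ∈ A, N < c.1 ∧ N < c.2 ∧ c.1 < -N ∧ c.2 < -N :=
    fun c hc => hN c (Finset.mem_union_left _ hc)
  have hNB : ∀ c ∈ B, N < c.1 ∧ N < c.2 ∧ c.1 < -N ∧ c.2 < -N :=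
    fun c hc => hN c (Finset.mem_union_right _ hc)
  have far : ∀ r, (r ≤ N ∨ -N ≤ r) → ¬ ZCov B r := by
    rintro r hr ⟨c, hc, h⟩
    have := hNB c hc
    omega
  have key : ∀ n : ℕ, ∀ u : ℤ → ZMod 2, (∀ c ∈ A, u c.1 = u c.2) → (∀ c ∈ B, u c.1 = u c.2) →
      (∀ x, ¬ ZCov B x → u x = 0) → (∀ x, N + n ≤ x → u x = 0) → ∀ x, u x = 0 := by
    intro n
    induction n with
    | zero =>
      intro u _ _ h0 h1 x
      by_cases hx : x ≤ N
      · exact h0 x (far x (Or.inl hx))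
      · exact h1 x (by simp; omega)
    | succ n ih =>
      intro u huA huB hu0 hun
      by_contra hne
      set w : ℤ → ZMod 2 := fun m => ∑ x ∈ Finset.Ico N m, u x with hw
      have wA : ∀ c ∈ A, w c.1 = w (c.2 + 1) := w_arc hA u huA N (fun c hc => (hNA c hc).1)
      have wB : ∀ c ∈ B, w c.1 = w (c.2 + 1) := w_arc hB u huB N (fun c hc => (hNB c hc).1)
      have wlow : ∀ m, m ≤ N → w m = 0 := by
        intro m hm
        simp [hw, hm]
      have wsucc : ∀ m, N ≤ m → w (m + 1) = w m + u m := by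
        intro m hm
        simp only [hw]
        rw [sum_split u hm (show m ≤ m + 1 by omega)]
        congr 1
        have : Finset.Ico m (m + 1) = {m} := by ext x; simp; omega
        rw [this, Finset.sum_singleton]
      have wray : ∀ r, ¬ ZCov B r → w (r + 1) = 0 := by
        intro r hr
        apply pair_sum hB u huB _ _ (fun x _ hx => hu0 x hx)
        intro c hc
        have h1 := hNB c hc
        have h2 := iff_of_eq (hB.sat_ray hr c hc)
        have h3 : r ≠ c.2 := fun h => hr ⟨c, hc, Or.inr h⟩
        simp only [Finset.mem_Ico]
        omega
      have whigh : ∀ m, N + n + 1 ≤ m → w m = 0 := by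
        intro m hm
        by_cases hmN : m ≤ N
        · exact wlow m hmN
        have h1 := wray (max m (-N)) (far _ (Or.inr (le_max_right _ _)))
        simp only [hw] at h1 ⊢
        rw [sum_split u (b := m) (by omega) (by omega)] at h1
        rw [Finset.sum_eq_zero (s := Finset.Ico m _), add_zero] at h1
        · exact h1
        · intro x hx
          apply hun
          rw [Finset.mem_Ico] at hx
          push_cast; omega
      set R : Finset ℤ := (Finset.Ico N (N + n + 1)).filter (fun m => w m ≠ 0) with hR
      have memR : ∀ m, m ∈ R ↔ w m ≠ 0 := by
        intro m
        rw [hR, Finset.mem_filter, Finset.mem_Ico]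
        constructor
        · exact fun h => h.2
        · intro h
          refine ⟨⟨?_, ?_⟩, h⟩
          · by_contra h'; exact h (wlow m (by omega))
          · by_contra h'; exact h (whigh m (by omega))
      have Rne : R.Nonempty := by
        by_contra hemp
        have w0 : ∀ m, w m = 0 := by
          intro m
          by_contra h
          exact hemp ⟨m, (memR m).2 h⟩
        apply hne
        intro x
        by_cases hx : N ≤ x
        · have := wsucc x hx
          rw [w0, w0, zero_add] at this
          exact this.symm
        · exact hu0 x (far x (Or.inl (by omega)))
      -- counting
      have cls_delta : ∀ c ∈ B, zcls B (δ c) = zcls B (c.1 + 1) := by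
        intro c hc
        obtain ⟨h1, h2, h3⟩ := hδ c hc
        obtain ⟨m', h4, h5, h6⟩ := hB.walk (δ c)
        have s1 := iff_of_eq (zcls_inv (fun x => c.1 < x ∧ x ≤ c.2) (hB.sat_arc hc) h5)
        have h7 := s1.2 ⟨h1, h2⟩
        by_cases h8 : m' = c.1 + 1
        · rw [← h5, h8]
        exfalso
        have hdc : ∃ d ∈ B, (m' - 1 = d.1 ∨ m' - 1 = d.2) := by
          obtain ⟨d, hd, h, _⟩ := hB.nested c hc (m' - 1) (by omega) (by omega)
          exact ⟨d, hd, h⟩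
        obtain ⟨d, hd, h9 | h9⟩ := hdc
        · have s2 := iff_of_eq (zcls_inv (fun x => d.1 < x ∧ x ≤ d.2) (hB.sat_arc hd) h5)
          have h10 := hB.lt d hd
          have h11 := s2.1 ⟨by omega, by omega⟩
          have h12 := h3 d hd (by rintro rfl; omega) h11.1 h11.2
          omega
        · exact h6 d hd (by omega)
      have top : ∀ m ∈ R, ∃ c ∈ B, zcls B (δ c) = zcls B m := by
        intro m hm
        obtain ⟨m', h4, h5, h6⟩ := hB.walk m
        have h7 : w m' ≠ 0 := by rw [zcls_inv w wB h5]; exact (memR m).1 hm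
        by_cases h8 : ZCov B (m' - 1)
        · obtain ⟨c, hc, h9 | h9⟩ := h8
          · refine ⟨c, hc, ?_⟩
            rw [cls_delta c hc, ← h5, ← h9]; simp
          · exact absurd (by omega) (h6 c hc)
        · have := wray _ h8
          rw [sub_add_cancel] at this
          exact absurd this h7
      have ct : (R.image (zcls B)).card ≤ ((B.image δ).filter (· ∈ R)).card := by
        refine le_trans (Finset.card_le_card ?_) (Finset.card_image_le (f := zcls B))
        intro q hq
        obtain ⟨m, hm, rfl⟩ := Finset.mem_image.1 hq
        obtain ⟨c, hc, h⟩ := top m hm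
        refine Finset.mem_image.2 ⟨δ c, Finset.mem_filter.2 ⟨Finset.mem_image_of_mem _ hc, ?_⟩, h⟩
        rw [memR, zcls_inv w wB h, ← memR]; exact hm
      set R1 := R.filter (fun m => ∃ c ∈ A, c.2 + 1 = m) with hR1
      set R2 := R.filter (fun m => ¬ ∃ c ∈ A, c.2 + 1 = m) with hR2
      have cR : R1.card + R2.card = R.card := Finset.card_filter_add_card_filter_not _
      have cb : (R.image (zcls A)).card ≤ R2.card := by
        refine le_trans (Finset.card_le_card ?_) (Finset.card_image_le (f := zcls A))
        intro q hq
        obtain ⟨m, hm, rfl⟩ := Finset.mem_image.1 hq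
        obtain ⟨m', h4, h5, h6⟩ := hA.walk m
        refine Finset.mem_image.2 ⟨m', Finset.mem_filter.2 ⟨?_, ?_⟩, h5⟩
        · rw [memR, zcls_inv w wA h5, ← memR]; exact hm
        · rintro ⟨c, hc, h⟩; exact h6 c hc h
      have cs : ((A.image ν).filter (· ∈ R)).card ≤ R1.card := by
        have e1 : (A.image ν).filter (· ∈ R) ⊆ (A.filter (fun c => c.2 + 1 ∈ R)).image ν := by
          intro m hm
          obtain ⟨h1, h2⟩ := Finset.mem_filter.1 hm
          obtain ⟨c, hc, rfl⟩ := Finset.mem_image.1 h1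
          refine Finset.mem_image_of_mem _ (Finset.mem_filter.2 ⟨hc, ?_⟩)
          rcases hν c hc with h | h
          · rw [memR, ← wA c hc, ← h, ← memR]; exact h2
          · rw [← h]; exact h2
        refine (Finset.card_le_card e1).trans (Finset.card_image_le.trans ?_)
        apply Finset.card_le_card_of_injOn (fun c => c.2 + 1)
        · intro c hc
          obtain ⟨h1, h2⟩ := Finset.mem_filter.1 hc
          exact Finset.mem_coe.2 (Finset.mem_filter.2 ⟨h2, c, h1, rfl⟩)
        · intro c hc d hd hcd
          have hc := (Finset.mem_filter.1 hc).1
          have hd := (Finset.mem_filter.1 hd).1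
          exact hA.same hc hd (x := c.2) (Or.inr rfl) (Or.inr (by simpa using hcd))
      obtain ⟨φ, ⟨m, hm, hφm⟩, hφB, hφA⟩ := cyc R Rne (zcls B) (zcls A) (by
        rw [him] at cs; omega)
      set v : ℤ → ZMod 2 := fun i => ∑ k ∈ R with k ≤ i, φ k with hv
      have vsplit : ∀ i j, i ≤ j → v j = v i + ∑ k ∈ R with i < k ∧ k ≤ j, φ k := by
        intro i j hij
        simp only [hv]
        rw [← Finset.sum_union]
        · apply Finset.sum_congr _ (fun _ _ => rfl)
          ext k; simp only [Finset.mem_filter, Finset.mem_union]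
          by_cases hk : k ∈ R <;> simp only [hk, true_and, false_and, or_self]
          omega
        · rw [Finset.disjoint_left]
          intro k h1 h2
          rw [Finset.mem_filter] at h1 h2
          omega
      have v0 : ∀ x, v x = 0 := by
        have vr : ∀ x, ¬ ZCov B x → v x = 0 := fun x hx =>
          sum_sat R φ hφB (fun k => k ≤ x) (hB.sat_ray hx)
        apply ih v
        · intro c hc
          rw [vsplit c.1 c.2 (hA.lt c hc).le,
            sum_sat R φ hφA (fun k => c.1 < k ∧ k ≤ c.2) (hA.sat_arc hc), add_zero]
        · intro c hc
          rw [vsplit c.1 c.2 (hB.lt c hc).le,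
            sum_sat R φ hφB (fun k => c.1 < k ∧ k ≤ c.2) (hB.sat_arc hc), add_zero]
        · exact vr
        · intro x hx
          have h1 := vr (max x (-N)) (far _ (Or.inr (le_max_right _ _)))
          rw [vsplit x _ (le_max_left _ _), Finset.sum_eq_zero, add_zero] at h1
          · exact h1
          · intro k hk
            obtain ⟨h2, h3⟩ := Finset.mem_filter.1 hk
            have h4 := Finset.mem_Ico.1 (Finset.mem_filter.1 h2).1
            omega
      apply hφm
      have h1 := vsplit (m - 1) m (by omega)
      rw [v0, v0, zero_add] at h1
      have h2 : R.filter (fun k => m - 1 < k ∧ k ≤ m) = {m} := by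
        ext k
        simp only [Finset.mem_filter, Finset.mem_singleton]
        constructor
        · intro h; omega
        · rintro rfl; exact ⟨hm, by omega, le_rfl⟩
      rw [h2, Finset.sum_singleton] at h1
      exact h1.symm
  refine key (-N - N).toNat u huA huB hu0 ?_
  intro x hx
  apply hu0 x (far x (Or.inr (by omega)))

lemma card_unc {A : Finset (ℤ × ℤ)} (hA : ZD A) (P : Finset ℤ) [DecidablePred (ZCov A)]
    (hP : ∀ c ∈ A, c.1 ∈ P ∧ c.2 ∈ P) :
    P.card = A.card + A.card + (P.filter (fun x => ¬ ZCov A x)).card := by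
  classical
  rw [← Finset.card_filter_add_card_filter_not (s := P) (ZCov A)]
  congr 1
  have h : P.filter (ZCov A) = A.image Prod.fst ∪ A.image Prod.snd := by
    ext x
    simp only [Finset.mem_filter, Finset.mem_union, Finset.mem_image]
    constructor
    · rintro ⟨_, c, hc, h | h⟩
      · exact Or.inl ⟨c, hc, h.symm⟩
      · exact Or.inr ⟨c, hc, h.symm⟩
    · rintro (⟨c, hc, rfl⟩ | ⟨c, hc, rfl⟩)
      · exact ⟨(hP c hc).1, c, hc, Or.inl rfl⟩
      · exact ⟨(hP c hc).2, c, hc, Or.inr rfl⟩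
  rw [h, Finset.card_union_of_disjoint, Finset.card_image_of_injOn, Finset.card_image_of_injOn]
  · intro c hc d hd hcd
    exact hA.same hc hd (x := c.2) (Or.inr rfl) (Or.inr hcd)
  · intro c hc d hd hcd
    exact hA.same hc hd (x := c.1) (Or.inl rfl) (Or.inl hcd)
  · rw [Finset.disjoint_left]
    intro x h1 h2
    obtain ⟨c, hc, rfl⟩ := Finset.mem_image.1 h1
    obtain ⟨d, hd, h⟩ := Finset.mem_image.1 h2
    have := hA.same hc hd (x := c.1) (Or.inl rfl) (Or.inr h.symm)
    subst this
    have := hA.lt c hc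
    omega

lemma surj_of {A B : Finset (ℤ × ℤ)} (P Q : Finset ℤ)
    (hcard : P.card = A.card + (B.card + Q.card))
    (hinj : ∀ u : ℤ → ZMod 2, (∀ c ∈ A, u c.1 = u c.2) → (∀ c ∈ B, u c.1 = u c.2) →
      (∀ x ∈ Q, u x = 0) → (∀ x, x ∉ P → u x = 0) → ∀ x, u x = 0) (q : ℤ → ZMod 2) :
    ∃ u : ℤ → ZMod 2, (∀ c ∈ A, u c.1 = u c.2) ∧ (∀ c ∈ B, u c.1 = u c.2) ∧
      (∀ x ∈ Q, u x = q x) := by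
  classical
  let ext : (P → ZMod 2) →ₗ[ZMod 2] (ℤ → ZMod 2) :=
    { toFun := fun f n => if h : n ∈ P then f ⟨n, h⟩ else 0
      map_add' := by intro f g; funext n; by_cases h : n ∈ P <;> simp [h]
      map_smul' := by intro f g; funext n; by_cases h : n ∈ P <;> simp [h] }
  let T : (P → ZMod 2) →ₗ[ZMod 2] ((A → ZMod 2) × ((B → ZMod 2) × (Q → ZMod 2))) :=
    { toFun := fun f => (fun c => ext f c.1.1 - ext f c.1.2, fun c => ext f c.1.1 - ext f c.1.2,
        fun x => ext f x)
      map_add' := by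
        intro f g
        ext a <;> simp <;> ring
      map_smul' := by
        intro f g
        ext a <;> simp <;> ring }
  have hT : Function.Injective T := by
    rw [injective_iff_map_eq_zero]
    intro f hf
    have h1 := hinj (ext f) ?_ ?_ ?_ ?_
    · funext ⟨x, hx⟩
      simpa [ext, hx] using h1 x
    · intro c hc
      exact sub_eq_zero.1 (congrFun (congrArg Prod.fst hf) ⟨c, hc⟩)
    · intro c hc
      exact sub_eq_zero.1 (congrFun (congrArg (fun z => z.2.1) hf) ⟨c, hc⟩)
    · intro c hc
      exact (congrFun (congrArg (fun z => z.2.2) hf) ⟨c, hc⟩)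
    · intro x hx
      simp [ext, hx]
  have hfr : Module.finrank (ZMod 2) (P → ZMod 2) =
        Module.finrank (ZMod 2) ((A → ZMod 2) × ((B → ZMod 2) × (Q → ZMod 2))) := by
    simp only [Module.finrank_prod, Module.finrank_fintype_fun_eq_card, Fintype.card_coe]
    exact hcard
  obtain ⟨f, hf⟩ := (LinearMap.injective_iff_surjective_of_finrank_eq_finrank hfr).1 hT
    (0, 0, fun x => q x)
  refine ⟨ext f, ?_, ?_, ?_⟩
  · intro c hc
    exact sub_eq_zero.1 (congrFun (congrArg Prod.fst hf) ⟨c, hc⟩)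
  · intro c hc
    exact sub_eq_zero.1 (congrFun (congrArg (fun z => z.2.1) hf) ⟨c, hc⟩)
  · intro c hc
    exact (congrFun (congrArg (fun z => z.2.2) hf) ⟨c, hc⟩)

lemma sep {A B : Finset (ℤ × ℤ)} (hA : ZD A) (hB : ZD B) (hAB : A.card = B.card)
    (hstar : ∀ u : ℤ → ZMod 2, (∀ c ∈ A, u c.1 = u c.2) → (∀ c ∈ B, u c.1 = u c.2) →
      (∀ x, ¬ ZCov B x → u x = 0) → ∀ x, u x = 0) (x y : ℤ) (hxy : x ≠ y) :
    (¬ ZCov B x → ¬ ZCov B y → ∃ u : ℤ → ZMod 2, (∀ c ∈ A, u c.1 = u c.2) ∧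
      (∀ c ∈ B, u c.1 = u c.2) ∧ u x ≠ u y) ∧
    (¬ ZCov A x → ¬ ZCov A y → ∃ u : ℤ → ZMod 2, (∀ c ∈ A, u c.1 = u c.2) ∧
      (∀ c ∈ B, u c.1 = u c.2) ∧ u x ≠ u y) := by
  classical
  let E : Finset (ℤ × ℤ) → Finset ℤ := fun A => A.image Prod.fst ∪ A.image Prod.snd
  let P : Finset ℤ := (E A ∪ E B) ∪ {x, y}
  have hPA : ∀ c ∈ A, c.1 ∈ P ∧ c.2 ∈ P := by
    intro c hc
    constructor
    · exact Finset.mem_union_left _ (Finset.mem_union_left _ (Finset.mem_union_left _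
        (Finset.mem_image_of_mem _ hc)))
    · exact Finset.mem_union_left _ (Finset.mem_union_left _ (Finset.mem_union_right _
        (Finset.mem_image_of_mem _ hc)))
  have hPB : ∀ c ∈ B, c.1 ∈ P ∧ c.2 ∈ P := by
    intro c hc
    constructor
    · exact Finset.mem_union_left _ (Finset.mem_union_right _ (Finset.mem_union_left _
        (Finset.mem_image_of_mem _ hc)))
    · exact Finset.mem_union_left _ (Finset.mem_union_right _ (Finset.mem_union_right _
        (Finset.mem_image_of_mem _ hc)))
  have hxP : x ∈ P := Finset.mem_union_right _ (by simp)
  have hyP : y ∈ P := Finset.mem_union_right _ (by simp)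
  have cA := card_unc hA P hPA
  have cB := card_unc hB P hPB
  have ht := surj_of (A := A) (B := B) P (P.filter (fun x => ¬ ZCov B x)) (by omega) (by
    intro u h1 h2 h3 h4
    apply hstar u h1 h2
    intro z hz
    by_cases hzP : z ∈ P
    · exact h3 z (Finset.mem_filter.2 ⟨hzP, hz⟩)
    · exact h4 z hzP)
  have hb := surj_of (A := A) (B := B) P (P.filter (fun x => ¬ ZCov A x)) (by omega) (by
    intro u h1 h2 h3 h4
    apply hstar u h1 h2
    intro z hz
    by_cases hzP : z ∈ P
    swap
    · exact h4 z hzP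
    obtain ⟨e, e1, e2, e3⟩ := ht (Pi.single z 1)
    have s1 : ∑ k ∈ P, u k * e k = 0 := by
      apply pair_sum hA (fun k => u k * e k)
      · intro c hc; simp only [h1 c hc, e1 c hc]
      · intro c hc; simp [hPA c hc]
      · intro k hk hk'
        simp only [h3 k (Finset.mem_filter.2 ⟨hk, hk'⟩), zero_mul]
    have s2 : ∑ k ∈ P.erase z, u k * e k = 0 := by
      apply pair_sum hB (fun k => u k * e k)
      · intro c hc; simp only [h2 c hc, e2 c hc]
      · intro c hc
        have n1 : c.1 ≠ z := fun h => hz ⟨c, hc, Or.inl h.symm⟩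
        have n2 : c.2 ≠ z := fun h => hz ⟨c, hc, Or.inr h.symm⟩
        simp [hPB c hc, n1, n2]
      · intro k hk hk'
        obtain ⟨k1, k2⟩ := Finset.mem_erase.1 hk
        simp only [e3 k (Finset.mem_filter.2 ⟨k2, hk'⟩), Pi.single_eq_of_ne k1, mul_zero]
    rw [← Finset.add_sum_erase _ _ hzP, s2, add_zero, e3 z (Finset.mem_filter.2 ⟨hzP, hz⟩),
      Pi.single_eq_same, mul_one] at s1
    exact s1)
  constructor
  · intro hx hy
    obtain ⟨u, h1, h2, h3⟩ := ht (Pi.single x 1)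
    refine ⟨u, h1, h2, ?_⟩
    rw [h3 x (Finset.mem_filter.2 ⟨hxP, hx⟩), h3 y (Finset.mem_filter.2 ⟨hyP, hy⟩),
      Pi.single_eq_same, Pi.single_eq_of_ne hxy.symm]
    exact one_ne_zero
  · intro hx hy
    obtain ⟨u, h1, h2, h3⟩ := hb (Pi.single x 1)
    refine ⟨u, h1, h2, ?_⟩
    rw [h3 x (Finset.mem_filter.2 ⟨hxP, hx⟩), h3 y (Finset.mem_filter.2 ⟨hyP, hy⟩),
      Pi.single_eq_same, Pi.single_eq_of_ne hxy.symm]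
    exact one_ne_zero

/-- the half-integer with index `k` -/
def hq (k : ℤ) : ℚ := (k : ℚ) + 1 / 2

lemma hq_inj {a b : ℤ} : hq a = hq b ↔ a = b := by simp [hq]
lemma hq_lt {a b : ℤ} : hq a < hq b ↔ a < b := by simp [hq]
lemma hq_le {a b : ℤ} : hq a ≤ hq b ↔ a ≤ b := by simp [hq]
lemma hq_lt_int {a m : ℤ} : hq a < (m : ℚ) ↔ a < m := by
  unfold hq
  constructor
  · intro h
    have : (a : ℚ) < m := by linarith
    exact_mod_cast this
  · intro h
    have : (a : ℚ) + 1 ≤ m := by exact_mod_cast h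
    linarith
lemma int_lt_hq {a m : ℤ} : (m : ℚ) < hq a ↔ m ≤ a := by
  rw [← not_iff_not, not_lt, not_le, ← hq_lt_int]
  constructor
  · intro h
    refine lt_of_le_of_ne h ?_
    intro h'
    unfold hq at h'
    have h2 : (2 * a + 1 : ℚ) = 2 * m := by linarith
    have h3 : 2 * a + 1 = 2 * m := by exact_mod_cast h2
    omega
  · exact le_of_lt

def hq2 (c : ℤ × ℤ) : ℚ × ℚ := (hq c.1, hq c.2)

lemma hq2_inj : Function.Injective hq2 := by
  rintro ⟨a, b⟩ ⟨c, d⟩ h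
  simp only [hq2, Prod.mk.injEq, hq_inj] at h
  simp [h.1, h.2]

noncomputable def zarcs (D : ArcDiagram) : Finset (ℤ × ℤ) :=
  D.arcs.preimage hq2 hq2_inj.injOn

lemma mem_zarcs {D : ArcDiagram} {c : ℤ × ℤ} : c ∈ zarcs D ↔ hq2 c ∈ D.arcs := by
  simp [zarcs]

lemma exists_zarc {D : ArcDiagram} {c : ℚ × ℚ} (hc : c ∈ D.arcs) : ∃ d ∈ zarcs D, hq2 d = c := by
  obtain ⟨i, hi⟩ := D.half_left c hc
  obtain ⟨j, hj⟩ := D.half_right c hc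
  have : hq2 (i, j) = c := Prod.ext hi.symm hj.symm
  exact ⟨(i, j), mem_zarcs.2 (this ▸ hc), this⟩

lemma image_zarcs (D : ArcDiagram) : (zarcs D).image hq2 = D.arcs := by
  ext c
  rw [Finset.mem_image]
  constructor
  · rintro ⟨d, hd, rfl⟩; exact mem_zarcs.1 hd
  · exact exists_zarc

lemma zarcs_ZD (D : ArcDiagram) : ZD (zarcs D) where
  lt c hc := hq_lt.1 (D.lt _ (mem_zarcs.1 hc))
  distinct c hc d hd hcd := by
    have := D.distinct _ (mem_zarcs.1 hc) _ (mem_zarcs.1 hd) (hq2_inj.ne hcd)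
    simpa only [hq2, ne_eq, hq_inj] using this
  nested c hc x h1 h2 := by
    obtain ⟨d, hd, h3, h4, h5⟩ := D.nested _ (mem_zarcs.1 hc) (hq x) ⟨x, rfl⟩ (hq_lt.2 h1) (hq_lt.2 h2)
    obtain ⟨d, hd', rfl⟩ := exists_zarc hd
    refine ⟨d, hd', ?_, hq_le.1 h4, hq_le.1 h5⟩
    simpa only [hq2, hq_inj] using h3

lemma zcov_iff {D : ArcDiagram} {x : ℤ} : ZCov (zarcs D) x ↔ D.Cov (hq x) := by
  constructor
  · rintro ⟨c, hc, h⟩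
    exact ⟨_, mem_zarcs.1 hc, by simpa only [hq2, hq_inj] using h⟩
  · rintro ⟨c, hc, h⟩
    obtain ⟨d, hd, rfl⟩ := exists_zarc hc
    exact ⟨d, hd, by simpa only [hq2, hq_inj] using h⟩

lemma adj_half {lam mu : ArcDiagram} {x y : ℚ} (h : CircAdj lam mu x y) :
    IsHalfInt x ∧ IsHalfInt y := by
  rcases h with h | h | h | h
  · exact ⟨lam.half_left _ h, lam.half_right _ h⟩
  · exact ⟨lam.half_right _ h, lam.half_left _ h⟩
  · exact ⟨mu.half_left _ h, mu.half_right _ h⟩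
  · exact ⟨mu.half_right _ h, mu.half_left _ h⟩

lemma conn_half {lam mu : ArcDiagram} {x y : ℚ} (h : CircConn lam mu x y) (hxy : x ≠ y) :
    IsHalfInt x ∧ IsHalfInt y := by
  constructor
  · rcases Relation.ReflTransGen.cases_head h with h | ⟨z, h, _⟩
    · exact absurd h hxy
    · exact (adj_half h).1
  · rcases Relation.ReflTransGen.cases_tail h with h | ⟨z, _, h⟩
    · exact absurd h.symm hxy
    · exact (adj_half h).2

lemma conn_eq {lam mu : ArcDiagram} {u : ℤ → ZMod 2}
    (h1 : ∀ c ∈ zarcs lam, u c.1 = u c.2) (h2 : ∀ c ∈ zarcs mu, u c.1 = u c.2)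
    {x y : ℤ} (h : CircConn lam mu (hq x) (hq y)) : u x = u y := by
  have key : ∀ z : ℚ, CircConn lam mu (hq x) z → ∀ y, z = hq y → u x = u y := by
    intro z hz
    induction hz with
    | refl => intro y hy; rw [hq_inj.1 hy]
    | tail _ hadj ih =>
      rintro y rfl
      obtain ⟨k, hk⟩ := (adj_half hadj).1
      rw [ih k hk]
      change _ = hq k at hk
      subst hk
      rcases hadj with h | h | h | h
      · exact h1 (k, y) (mem_zarcs.2 h)
      · exact (h1 (y, k) (mem_zarcs.2 h)).symm
      · exact h2 (k, y) (mem_zarcs.2 h)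
      · exact (h2 (y, k) (mem_zarcs.2 h)).symm
  exact key _ h y rfl

/-- If there exist a `∇`-orientation of the cup diagram `lam` and a `Δ`-orientation of the
cap diagram `mu` whose sets of assigned integers coincide, then the circle diagram
`lam mu` is orientable. -/
theorem orientable_of_matching_orientations (lam mu : ArcDiagram) (ν δ : ℚ × ℚ → ℤ)
    (hν : IsNablaOrientation lam ν) (hδ : IsDeltaOrientation mu δ)
    (him : lam.arcs.image ν = mu.arcs.image δ) :
    Orientable lam mu := by
  classical
  have hA := zarcs_ZD lam
  have hB := zarcs_ZD mu
  have cA : (zarcs lam).card = lam.arcs.card := by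
    rw [← image_zarcs lam, Finset.card_image_of_injective _ hq2_inj]
  have cB : (zarcs mu).card = mu.arcs.card := by
    rw [← image_zarcs mu, Finset.card_image_of_injective _ hq2_inj]
  have cAB : (zarcs lam).card = (zarcs mu).card := by
    rw [cA, cB, ← Finset.card_image_of_injOn (s := lam.arcs) (f := ν) (fun c hc d hd h => hν.2 c hc d hd h),
      ← Finset.card_image_of_injOn (s := mu.arcs) (f := δ) (fun c hc d hd h => hδ.2 c hc d hd h), him]
  have hstar := star hA hB (ν ∘ hq2) (δ ∘ hq2)
    (by
      intro c hc
      rcases hν.1 _ (mem_zarcs.1 hc) with h | h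
      · left
        have h' : (ν (hq2 c) : ℚ) = (c.1 : ℚ) := by rw [h]; simp [hq2, hq]
        exact_mod_cast h'
      · right
        have h' : (ν (hq2 c) : ℚ) = (c.2 : ℚ) + 1 := by rw [h]; simp only [hq2, hq]; ring
        exact_mod_cast h')
    (by
      intro c hc
      obtain ⟨h1, h2, h3⟩ := hδ.1 _ (mem_zarcs.1 hc)
      refine ⟨hq_lt_int.1 h1, int_lt_hq.1 h2, ?_⟩
      intro d hd hdc h4 h5
      obtain ⟨h6, h7⟩ := h3 _ (mem_zarcs.1 hd) (hq2_inj.ne hdc) (hq_lt_int.2 h4) (int_lt_hq.2 h5)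
      exact ⟨hq_lt.1 h6, hq_lt.1 h7⟩)
    (by rw [← Finset.image_image, ← Finset.image_image, image_zarcs, image_zarcs, him])
  refine ⟨?_, ?_⟩
  · rintro ⟨x, hx⟩
    obtain ⟨c, hc, hxc⟩ := (hx x Relation.ReflTransGen.refl).1
    have hxh : IsHalfInt x := by
      rcases hxc with rfl | rfl
      · exact lam.half_left _ hc
      · exact lam.half_right _ hc
    obtain ⟨k, hk⟩ := hxh
    change x = hq k at hk
    subst hk
    have h0 := hstar (fun z => if CircConn lam mu (hq k) (hq z) then 1 else 0) ?_ ?_ ?_ k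
    · have : CircConn lam mu (hq k) (hq k) := Relation.ReflTransGen.refl
      simp [this] at h0
    · intro d hd
      have e : CircConn lam mu (hq k) (hq d.1) ↔ CircConn lam mu (hq k) (hq d.2) :=
        ⟨fun h => h.tail (Or.inl (mem_zarcs.1 hd)), fun h => h.tail (Or.inr (Or.inl (mem_zarcs.1 hd)))⟩
      simp only [e]
    · intro d hd
      have e : CircConn lam mu (hq k) (hq d.1) ↔ CircConn lam mu (hq k) (hq d.2) :=
        ⟨fun h => h.tail (Or.inr (Or.inr (Or.inl (mem_zarcs.1 hd)))),
          fun h => h.tail (Or.inr (Or.inr (Or.inr (mem_zarcs.1 hd))))⟩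
      simp only [e]
    · intro z hz
      rw [if_neg]
      intro h
      exact hz (zcov_iff.2 (hx _ h).2)
  · intro g h _ _
    constructor
    · intro x y hxy hc hx hy
      exfalso
      obtain ⟨⟨a, ha⟩, ⟨b, hb⟩⟩ := conn_half hc hxy
      change x = hq a at ha
      change y = hq b at hb
      subst ha hb
      obtain ⟨u, h1, h2, h3⟩ := (sep hA hB cAB hstar a b (fun e => hxy (by rw [e]))).1
        (fun e => hx (zcov_iff.1 e)) (fun e => hy (zcov_iff.1 e))
      exact h3 (conn_eq h1 h2 hc)
    · intro x y hxy hc hx hy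
      exfalso
      obtain ⟨⟨a, ha⟩, ⟨b, hb⟩⟩ := conn_half hc hxy
      change x = hq a at ha
      change y = hq b at hb
      subst ha hb
      obtain ⟨u, h1, h2, h3⟩ := (sep hA hB cAB hstar a b (fun e => hxy (by rw [e]))).2
        (fun e => hx (zcov_iff.1 e)) (fun e => hy (zcov_iff.1 e))
      exact h3 (conn_eq h1 h2 hc)
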